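/- Let p be a prime and q = p^a with a ≥ 2. Let k > 1 be a natural number such that some prime divides a but does not divide k, and let a' be the π(k)-part of a, i.e., the largest divisor of a all of whose prime divisors divide k. If both R_{ka}(p) and R_{ka'}(p) are nonempty, then R_k(q) contains at least two distinct primes. -/

import Mathlib

/-- `r` is a primitive prime divisor of `n ^ i - 1`: a prime dividing `n ^ i - 1`
but no `n ^ k - 1` for `1 ≤ k < i`. -/
def IsPPD (n : ℤ) (i : ℕ) (r : ℕ) : Prop :=
  r.Prime ∧ (r : ℤ) ∣ n ^ i - 1 ∧ ∀ k : ℕ, 1 ≤ k → k < i → ¬ (r : ℤ) ∣ n ^ k - 1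

theorem isPPD_iff (n : ℤ) (i r : ℕ) (hi : 0 < i) :
    IsPPD n i r ↔ r.Prime ∧ orderOf (n : ZMod r) = i := by
  have key : ∀ j : ℕ, (r : ℤ) ∣ n ^ j - 1 ↔ (n : ZMod r) ^ j = 1 := by
    intro j
    rw [← CharP.intCast_eq_zero_iff (ZMod r) r, Int.cast_sub, sub_eq_zero]
    simp
  unfold IsPPD
  simp only [key]
  rw [orderOf_eq_iff hi]
  constructor
  · rintro ⟨h1, h2, h3⟩
    exact ⟨h1, h2, fun m hm hm0 => h3 m hm0 hm⟩
  · rintro ⟨h1, h2, h3⟩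
    exact ⟨h1, h2, fun m hm0 hm => h3 m hm hm0⟩

/-- let `q = p ^ a` with `a ≥ 2`, let `k > 1` be such that some
prime divides `a` but not `k`, and let `a'` be the `π(k)`-part of `a` (the
greatest divisor of `a` all of whose prime divisors divide `k`). If primitive
prime divisors of `p ^ (k * a) - 1` and `p ^ (k * a') - 1` exist, then `q ^ k - 1`
has at least two distinct primitive prime divisors. -/
theorem two_ppds (p : ℕ) (hp : p.Prime) (a : ℕ) (ha : 2 ≤ a) (k : ℕ) (hk : 1 < k)
    (hne : ∃ r : ℕ, r.Prime ∧ r ∣ a ∧ ¬ r ∣ k)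
    (a' : ℕ) (ha'dvd : a' ∣ a) (ha'pi : ∀ r : ℕ, r.Prime → r ∣ a' → r ∣ k)
    (ha'max : ∀ m : ℕ, m ∣ a → (∀ r : ℕ, r.Prime → r ∣ m → r ∣ k) → m ≤ a')
    (h₁ : ∃ r : ℕ, IsPPD (p : ℤ) (k * a) r) (h₂ : ∃ r : ℕ, IsPPD (p : ℤ) (k * a') r) :
    ∃ r s : ℕ, r ≠ s ∧ IsPPD ((p : ℤ) ^ a) k r ∧ IsPPD ((p : ℤ) ^ a) k s := by
  obtain ⟨r, hr⟩ := h₁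
  obtain ⟨s, hs⟩ := h₂
  obtain ⟨b, rfl⟩ := ha'dvd
  have ha0 : 0 < a' := Nat.pos_of_ne_zero (by rintro rfl; simp at ha)
  have hb0 : 0 < b := Nat.pos_of_ne_zero (by rintro rfl; simp at ha)
  have hk0 : 0 < k := by omega
  have hcop : Nat.Coprime k b := by
    apply Nat.Coprime.symm
    by_contra hc
    obtain ⟨l, hl, hlb, hlk⟩ := Nat.Prime.not_coprime_iff_dvd.1 hc
    have := ha'max (a' * l) (Nat.mul_dvd_mul_left _ hlb) (by
      intro t ht htd
      rcases (Nat.Prime.dvd_mul ht).1 htd with h | h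
      · exact ha'pi t ht h
      · exact h.trans hlk)
    have := hl.two_le
    nlinarith
  have hb1 : b ≠ 1 := by
    rintro rfl
    obtain ⟨t, ht, hta, htk⟩ := hne
    exact htk (ha'pi t ht (by simpa using hta))
  rw [isPPD_iff _ _ _ (by positivity)] at hr hs
  refine ⟨r, s, ?_, ?_, ?_⟩
  · rintro rfl
    have h := hr.2.symm.trans hs.2
    have h2 := Nat.eq_of_mul_eq_mul_left hk0 h
    exact hb1 (Nat.eq_of_mul_eq_mul_left ha0 (by simpa using h2))
  · rw [isPPD_iff _ _ _ hk0]
    refine ⟨hr.1, ?_⟩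
    have hne0 : a' * b ≠ 0 := by positivity
    rw [Int.cast_pow, orderOf_pow' _ hne0, hr.2, Nat.gcd_mul_left_left,
      Nat.mul_div_cancel _ (by positivity)]
  · rw [isPPD_iff _ _ _ hk0]
    refine ⟨hs.1, ?_⟩
    have hne0 : a' * b ≠ 0 := by positivity
    rw [Int.cast_pow, orderOf_pow' _ hne0, hs.2, mul_comm k a', Nat.gcd_mul_left,
      Nat.Coprime.gcd_eq_one hcop, mul_one, Nat.mul_div_cancel_left _ ha0]
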